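/- arXiv:2208.14283 — 2 statements merged into one kernel-verified Lean document; each statement's English description precedes it below -/
import Mathlib

section
/- Let σ : ℝ → ℝ be bounded and differentiable with bounded derivative, let α_n ≥ 1, γ*_n ≥ 1, B_n ≥ 1, r ≥ 2d, and let w, v be weight vectors such that |w^{(L)}_{1,1,k}| ≤ γ*_n and |v^{(L)}_{1,1,k}| ≤ γ*_n for k = 1,…,K_n, and |w^{(l)}_{k,i,j}| ≤ B_n and |v^{(l)}_{k,i,j}| ≤ B_n for l = 1,…,L−1. Then for any x ∈ [−α_n,α_n]^d, |f_w(x) − f_v(x)| ≤ 2·K_n·max{‖σ'‖_∞^L, 1}·γ*_n·(2r+1)^L·B_n^L·α_n·max{‖σ‖_∞, 1}·‖w − v‖_∞. -/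
open MeasureTheory ProbabilityTheory Filter

noncomputable section

/-- The logistic squasher `σ(x) = 1/(1+e^{-x})`. -/
def sigLog : ℝ → ℝ := fun x => 1 / (1 + Real.exp (-x))

/-- Index type for the weights of a linear combination of `Kn` fully connected deep networks
with `L` layers, `r` neurons per layer and input dimension `d`:
`Sum.inl (k, i, j)` is the level-0 weight `w^{(0)}_{k,i+1,j}` (`j = 0` is the bias,
`j = t+1` multiplies `x^{(t+1)}`); `Sum.inr (Sum.inl (k, m, i, j))` is the inner weight
`w^{(m+1)}_{k,i+1,j}` for the levels `m+1 ∈ {1,…,L-1}` (`j = 0` is the bias, `j = t+1`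
multiplies the output of neuron `t+1`); `Sum.inr (Sum.inr j)` is the output weight
`w^{(L)}_{1,1,j+1}`. -/
abbrev Idx (Kn L r d : ℕ) : Type :=
  (Fin Kn × Fin r × Fin (d + 1)) ⊕ ((Fin Kn × Fin (L - 1) × Fin r × Fin (r + 1)) ⊕ Fin Kn)

/-- `hid σ Kn L r d w k m i x` is the output `f^{(m+1)}_{k,i+1}(x)` of neuron `i+1` in
layer `m+1` of the `k`-th fully connected subnetwork. -/
def hid (σ : ℝ → ℝ) (Kn L r d : ℕ) (w : EuclideanSpace ℝ (Idx Kn L r d)) (k : Fin Kn) :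
    ℕ → Fin r → (Fin d → ℝ) → ℝ
  | 0 => fun i x =>
      σ ((∑ j : Fin d, w (Sum.inl (k, i, j.succ)) * x j) + w (Sum.inl (k, i, 0)))
  | (m + 1) => fun i x =>
      σ ((∑ j : Fin r,
            (if h : m < L - 1 then w (Sum.inr (Sum.inl (k, ⟨m, h⟩, i, j.succ))) else 0) *
              hid σ Kn L r d w k m j x) +
          (if h : m < L - 1 then w (Sum.inr (Sum.inl (k, ⟨m, h⟩, i, 0))) else 0))

/-- Output `f^{(L)}_{k,1}` of the `k`-th fully connected subnetwork. -/
def subnet (σ : ℝ → ℝ) (Kn L r d : ℕ) (w : EuclideanSpace ℝ (Idx Kn L r d)) (k : Fin Kn)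
    (x : Fin d → ℝ) : ℝ :=
  if h : 0 < r then hid σ Kn L r d w k (L - 1) ⟨0, h⟩ x else 0

/-- The deep network `f_w(x) = ∑_{j=1}^{K_n} w^{(L)}_{1,1,j} · f^{(L)}_{j,1}(x)`. -/
def netF (σ : ℝ → ℝ) (Kn L r d : ℕ) (w : EuclideanSpace ℝ (Idx Kn L r d))
    (x : Fin d → ℝ) : ℝ :=
  ∑ j : Fin Kn, w (Sum.inr (Sum.inr j)) * subnet σ Kn L r d w j x

/-- Indicator function of the cube `[-α,α]^d`. -/
def cubeInd (d : ℕ) (α : ℝ) (x : Fin d → ℝ) : ℝ :=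
  Set.indicator {y : Fin d → ℝ | ∀ j, |y j| ≤ α} (fun _ => (1 : ℝ)) x

/-- The regularized empirical L₂ risk
`F_n(w) = (1/n) ∑_i |f_w(X_i) - Y_i|² 1_{[-α_n,α_n]^d}(X_i) + c₂ ∑_j |w^{(L)}_{1,1,j}|²`. -/
def empRisk (σ : ℝ → ℝ) (Kn L r d n : ℕ) (X : Fin n → Fin d → ℝ) (Y : Fin n → ℝ)
    (αn c2 : ℝ) (w : EuclideanSpace ℝ (Idx Kn L r d)) : ℝ :=
  (1 / (n : ℝ)) * ∑ i : Fin n, (netF σ Kn L r d w (X i) - Y i) ^ 2 * cubeInd d αn (X i)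
    + c2 * ∑ j : Fin Kn, (w (Sum.inr (Sum.inr j))) ^ 2

/-- Truncation operator `T_β z = max{-β, min{β, z}}`. -/
def Tbeta (β z : ℝ) : ℝ := max (-β) (min β z)

/-- A differentiable function whose derivative is bounded by `C` is `C`-Lipschitz. -/
theorem abs_sub_le_of_abs_deriv_le {σ : ℝ → ℝ} (hσ : Differentiable ℝ σ) {C : ℝ}
    (hC : ∀ y, |deriv σ y| ≤ C) (a b : ℝ) : |σ a - σ b| ≤ C * |a - b| := by
  simpa only [Real.norm_eq_abs] using
    convex_univ.norm_image_sub_le_of_norm_deriv_le (f := σ) (fun y _ => hσ y)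
      (fun y _ => hC y) (Set.mem_univ b) (Set.mem_univ a)

theorem abs_mul_sub_mul_le {a b p q A E δ M : ℝ} (ha : |a| ≤ A) (hpq : |p - q| ≤ E)
    (hab : |a - b| ≤ δ) (hq : |q| ≤ M) : |a * p - b * q| ≤ A * E + δ * M := by
  have h : a * p - b * q = a * (p - q) + (a - b) * q := by ring
  have hA : 0 ≤ A := (abs_nonneg a).trans ha
  have hδ : 0 ≤ δ := (abs_nonneg _).trans hab
  rw [h]
  refine (abs_add_le _ _).trans ?_
  rw [abs_mul, abs_mul]
  gcongr

theorem abs_sum_sub_sum_le {n : ℕ} {f g : Fin n → ℝ} {c : ℝ} (h : ∀ j, |f j - g j| ≤ c) :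
    |∑ j, f j - ∑ j, g j| ≤ n * c := by
  rw [← Finset.sum_sub_distrib]
  refine (Finset.abs_sum_le_sum_abs _ _).trans ?_
  refine (Finset.sum_le_sum fun j _ => h j).trans ?_
  simp

theorem abs_hid_le {σ : ℝ → ℝ} {M : ℝ} (hM : ∀ y, |σ y| ≤ M) {Kn L r d : ℕ}
    (w : EuclideanSpace ℝ (Idx Kn L r d)) (k : Fin Kn) (m : ℕ) (i : Fin r) (x : Fin d → ℝ) :
    |hid σ Kn L r d w k m i x| ≤ M := by
  cases m <;> exact hM _

/-- The outputs of the layer with index `m` are Lipschitz in the weights. -/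
theorem abs_hid_sub_hid_le {σ : ℝ → ℝ} (hσ : Differentiable ℝ σ) {C M α B δ : ℝ}
    (hC : ∀ y, |deriv σ y| ≤ C) (hC1 : 1 ≤ C) (hM : ∀ y, |σ y| ≤ M) (hM1 : 1 ≤ M)
    (hα : 1 ≤ α) (hB : 1 ≤ B) {Kn L r d : ℕ} (hdr : d ≤ 2 * r)
    (w v : EuclideanSpace ℝ (Idx Kn L r d)) (hδ : ∀ idx, |w idx - v idx| ≤ δ) (hδ0 : 0 ≤ δ)
    (hw : ∀ (k : Fin Kn) (l : Fin (L - 1)) (i : Fin r) (j : Fin (r + 1)),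
      |w (Sum.inr (Sum.inl (k, l, i, j)))| ≤ B)
    (x : Fin d → ℝ) (hx : ∀ j, |x j| ≤ α) (k : Fin Kn) (m : ℕ) (hm : m ≤ L - 1) (i : Fin r) :
    |hid σ Kn L r d w k m i x - hid σ Kn L r d v k m i x| ≤
      C ^ (m + 1) * (2 * r + 1) ^ (m + 1) * B ^ m * α * M * δ := by
  induction m generalizing i with
  | zero =>
    refine (abs_sub_le_of_abs_deriv_le hσ hC _ _).trans ?_
    have hsum : |∑ j : Fin d, w (Sum.inl (k, i, j.succ)) * x j -
        ∑ j : Fin d, v (Sum.inl (k, i, j.succ)) * x j| ≤ d * (δ * α) := by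
      refine abs_sum_sub_sum_le fun j => ?_
      rw [← sub_mul, abs_mul]
      exact mul_le_mul (hδ _) (hx j) (abs_nonneg _) hδ0
    have hd : (d : ℝ) ≤ 2 * r := by exact_mod_cast hdr
    have hδα : δ ≤ δ * α := le_mul_of_one_le_right hδ0 hα
    have key : d * (δ * α) + δ ≤ (2 * r + 1) * (δ * α) * M := by
      calc d * (δ * α) + δ ≤ 2 * r * (δ * α) + δ * α := by gcongr
        _ = (2 * r + 1) * (δ * α) := by ring
        _ ≤ _ := le_mul_of_one_le_right (by positivity) hM1
    rw [add_sub_add_comm]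
    calc C * _ ≤ C * ((2 * r + 1) * (δ * α) * M) := by
          gcongr
          exact (abs_add_le _ _).trans ((add_le_add hsum (hδ _)).trans key)
      _ = _ := by ring
  | succ m ih =>
    have hmL : m < L - 1 := hm
    set E : ℝ := C ^ (m + 1) * (2 * r + 1) ^ (m + 1) * B ^ m * α * M * δ with hE
    have hsum := abs_sum_sub_sum_le fun j : Fin r =>
      abs_mul_sub_mul_le (hw k ⟨m, hmL⟩ i j.succ) (ih hmL.le j)
        (hδ (Sum.inr (Sum.inl (k, ⟨m, hmL⟩, i, j.succ)))) (abs_hid_le hM v k m j x)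
    have hME : M * δ ≤ E := by
      have h1 : 1 ≤ C ^ (m + 1) * (2 * (r : ℝ) + 1) ^ (m + 1) * B ^ m * α := by
        have := one_le_pow₀ hC1 (n := m + 1)
        have := one_le_pow₀ hB (n := m)
        have := one_le_pow₀ (show (1 : ℝ) ≤ 2 * r + 1 by simp) (n := m + 1)
        refine one_le_mul_of_one_le_of_one_le (one_le_mul_of_one_le_of_one_le
          (one_le_mul_of_one_le_of_one_le ?_ ?_) ?_) hα <;> assumption
      rw [hE, mul_assoc _ M δ]
      exact le_mul_of_one_le_left (by positivity) h1
    have hE0 : 0 ≤ E := le_trans (by positivity) hME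
    have hEB : E ≤ B * E := le_mul_of_one_le_left hE0 hB
    have hδM : δ ≤ M * δ := le_mul_of_one_le_left hδ0 hM1
    have hδME : δ * M ≤ B * E := by linarith
    have hδE : δ ≤ B * E := by linarith
    have key : r * (B * E + δ * M) + δ ≤ (2 * r + 1) * (B * E) := by
      calc r * (B * E + δ * M) + δ ≤ r * (B * E + B * E) + B * E := by
            gcongr
        _ = _ := by ring
    simp only [hid, hmL, dite_true]
    refine (abs_sub_le_of_abs_deriv_le hσ hC _ _).trans ?_
    rw [add_sub_add_comm]
    calc C * _ ≤ C * ((2 * r + 1) * (B * E)) := by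
          gcongr
          exact (abs_add_le _ _).trans ((add_le_add hsum (hδ _)).trans key)
      _ = _ := by rw [hE]; ring

/-- The network is Lipschitz in its weight vector (sup-norm of the weight difference). -/
theorem network_lipschitz_in_weights
    (d r L Kn : ℕ) (hd : 0 < d) (hKn : 0 < Kn) (hL : 2 ≤ L) (hr : 2 * d ≤ r)
    (σ : ℝ → ℝ) (hσdiff : Differentiable ℝ σ)
    (hσbdd : ∃ M, ∀ x, |σ x| ≤ M) (hσ'bdd : ∃ M, ∀ x, |deriv σ x| ≤ M)
    (αn γ B : ℝ) (hα : 1 ≤ αn) (hγ : 1 ≤ γ) (hB : 1 ≤ B)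
    (w v : EuclideanSpace ℝ (Idx Kn L r d))
    (hwout : ∀ k : Fin Kn, |w (Sum.inr (Sum.inr k))| ≤ γ)
    (hvout : ∀ k : Fin Kn, |v (Sum.inr (Sum.inr k))| ≤ γ)
    (hwin : ∀ (k : Fin Kn) (l : Fin (L - 1)) (i : Fin r) (j : Fin (r + 1)),
      |w (Sum.inr (Sum.inl (k, l, i, j)))| ≤ B)
    (hvin : ∀ (k : Fin Kn) (l : Fin (L - 1)) (i : Fin r) (j : Fin (r + 1)),
      |v (Sum.inr (Sum.inl (k, l, i, j)))| ≤ B)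
    (x : Fin d → ℝ) (hx : ∀ j, |x j| ≤ αn) :
    |netF σ Kn L r d w x - netF σ Kn L r d v x| ≤
      2 * Kn * max ((⨆ y, |deriv σ y|) ^ L) 1 * γ * (2 * r + 1) ^ L * B ^ L * αn *
        max (⨆ y, |σ y|) 1 * (⨆ idx : Idx Kn L r d, |w idx - v idx|) := by
  obtain ⟨S, hS⟩ := hσbdd
  obtain ⟨D, hD⟩ := hσ'bdd
  have hr0 : 0 < r := by omega
  rw [show max ((⨆ y, |deriv σ y|) ^ L) 1 = max (⨆ y, |deriv σ y|) 1 ^ L by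
    have h0 : 0 ≤ ⨆ y, |deriv σ y| := Real.iSup_nonneg fun y => abs_nonneg _
    rcases le_total (⨆ y, |deriv σ y|) 1 with h | h
    · rw [max_eq_right h, max_eq_right (pow_le_one₀ h0 h), one_pow]
    · rw [max_eq_left h, max_eq_left (one_le_pow₀ h)]]
  have hM : ∀ y, |σ y| ≤ max (⨆ y, |σ y|) 1 := fun y =>
    (le_ciSup (f := fun y => |σ y|) ⟨S, by rintro _ ⟨y, rfl⟩; exact hS y⟩ y).trans
      (le_max_left _ _)
  have hC : ∀ y, |deriv σ y| ≤ max (⨆ y, |deriv σ y|) 1 := fun y =>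
    (le_ciSup (f := fun y => |deriv σ y|) ⟨D, by rintro _ ⟨y, rfl⟩; exact hD y⟩ y).trans
      (le_max_left _ _)
  have hδ : ∀ idx, |w idx - v idx| ≤ ⨆ idx : Idx Kn L r d, |w idx - v idx| := fun idx =>
    le_ciSup (f := fun idx => |w idx - v idx|) (Set.finite_range _).bddAbove idx
  have hδ0 : 0 ≤ ⨆ idx : Idx Kn L r d, |w idx - v idx| :=
    Real.iSup_nonneg fun _ => abs_nonneg _
  have hM1 : 1 ≤ max (⨆ y, |σ y|) 1 := le_max_right _ _
  have hC1 : 1 ≤ max (⨆ y, |deriv σ y|) 1 := le_max_right _ _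
  generalize max (⨆ y, |σ y|) 1 = M at *
  generalize max (⨆ y, |deriv σ y|) 1 = C at *
  generalize (⨆ idx : Idx Kn L r d, |w idx - v idx|) = δ at *
  have hsub : ∀ j, |subnet σ Kn L r d w j x - subnet σ Kn L r d v j x| ≤
      C ^ L * (2 * r + 1) ^ L * B ^ L * αn * M * δ := fun j => by
    have h := abs_hid_sub_hid_le hσdiff hC hC1 hM hM1 hα hB (by omega) w v hδ hδ0 hwin x hx j
      (L - 1) le_rfl ⟨0, hr0⟩
    rw [Nat.sub_add_cancel (by omega : 1 ≤ L)] at h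
    simp only [subnet, hr0, dite_true]
    refine h.trans ?_
    gcongr
    omega
  have hout := abs_sum_sub_sum_le fun j : Fin Kn =>
    abs_mul_sub_mul_le (hwout j) (hsub j) (hδ (Sum.inr (Sum.inr j)))
      (show |subnet σ Kn L r d v j x| ≤ M by
        simpa only [subnet, hr0, dite_true] using abs_hid_le hM v j (L - 1) ⟨0, hr0⟩ x)
  have hlast : δ * M ≤ γ * (C ^ L * (2 * r + 1) ^ L * B ^ L * αn * M * δ) := by
    have h1 : 1 ≤ γ * (C ^ L * (2 * (r : ℝ) + 1) ^ L * B ^ L * αn) := by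
      have := one_le_pow₀ hC1 (n := L)
      have := one_le_pow₀ hB (n := L)
      have := one_le_pow₀ (show (1 : ℝ) ≤ 2 * r + 1 by simp) (n := L)
      refine one_le_mul_of_one_le_of_one_le hγ (one_le_mul_of_one_le_of_one_le
        (one_le_mul_of_one_le_of_one_le (one_le_mul_of_one_le_of_one_le ?_ ?_) ?_) hα) <;>
        assumption
    calc δ * M ≤ γ * (C ^ L * (2 * r + 1) ^ L * B ^ L * αn) * (δ * M) :=
          le_mul_of_one_le_left (by positivity) h1
      _ = _ := by ring
  refine hout.trans ?_
  calc (Kn : ℝ) * _ ≤ Kn * (γ * (C ^ L * (2 * r + 1) ^ L * B ^ L * αn * M * δ) +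
        γ * (C ^ L * (2 * r + 1) ^ L * B ^ L * αn * M * δ)) := by gcongr
    _ = _ := by ring

end
end

section
/- Let A, B, C ≥ 1, let k ∈ ℕ, and let σ : ℝ → ℝ be k-times differentiable such that all derivatives up to order k are bounded on ℝ. Let w be a weight vector satisfying Σ_{j=1}^{K_n} |w^{(L)}_{1,1,j}| ≤ C, |w^{(l)}_{k,i,j}| ≤ B for all k ∈ {1,…,K_n}, i,j ∈ {1,…,r}, l ∈ {1,…,L−1}, and |w^{(0)}_{k,i,j}| ≤ A for all k ∈ {1,…,K_n}, i ∈ {1,…,r}, j ∈ {1,…,d}. Then there exists a constant c₁₄ > 0, depending only on σ, k, d, r and L, such that for all x ∈ ℝ^d and all s₁,…,s_k ∈ {1,…,d}, |∂^k f_w / (∂x^{(s₁)} ⋯ ∂x^{(s_k)}) (x)| ≤ c₁₄ · C · B^{(L−1)·k} · A^k. -/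
open MeasureTheory ProbabilityTheory Filter

noncomputable section

/-- Derivatives of a finite linear combination are controlled by the `ℓ¹`-norm of the
coefficients. -/
lemma norm_iteratedFDeriv_sum_mul_le {E ι : Type*} [NormedAddCommGroup E] [NormedSpace ℝ E]
    [Fintype ι] {n : ℕ} {a : ι → ℝ} {h : ι → E → ℝ} {x : E} {D : ℝ}
    (hh : ∀ j, ContDiff ℝ n (h j)) (hD : ∀ j, ‖iteratedFDeriv ℝ n (h j) x‖ ≤ D) :
    ‖iteratedFDeriv ℝ n (fun y => ∑ j, a j * h j y) x‖ ≤ (∑ j, |a j|) * D := by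
  have hc : ∀ j, ContDiff ℝ n (fun y => a j * h j y) := fun j => contDiff_const.mul (hh j)
  rw [iteratedFDeriv_fun_sum_apply fun j _ => (hc j).contDiffAt, Finset.sum_mul]
  refine norm_sum_le_of_le _ fun j _ => ?_
  have hsmul : iteratedFDeriv ℝ n (fun y => a j * h j y) x = a j • iteratedFDeriv ℝ n (h j) x :=
    iteratedFDeriv_const_smul_apply (a := a j) (hh j).contDiffAt
  rw [hsmul, norm_smul, Real.norm_eq_abs]
  exact mul_le_mul_of_nonneg_left (hD j) (abs_nonneg _)

/-- Derivatives of a neuron `σ (∑ j, a j * h j + b)` in terms of derivatives of its inputs. -/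
lemma norm_iteratedFDeriv_neuron_le {E ι : Type*} [NormedAddCommGroup E] [NormedSpace ℝ E]
    [Fintype ι] {k : ℕ} {σ : ℝ → ℝ} (hσ : ContDiff ℝ k σ) {M : ℝ}
    (hM : ∀ i ≤ k, ∀ t, |iteratedDeriv i σ t| ≤ M) {a : ι → ℝ} {b : ℝ} {h : ι → E → ℝ}
    (hh : ∀ j, ContDiff ℝ k (h j)) {c N S T : ℝ} (hc : 1 ≤ c) (hN : 1 ≤ N)
    (hcard : (Fintype.card ι : ℝ) ≤ N) (hS : 1 ≤ S) (hT : 0 ≤ T) (ha : ∀ j, |a j| ≤ S) {x : E}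
    (hD : ∀ j, ∀ i, 1 ≤ i → i ≤ k → ‖iteratedFDeriv ℝ i (h j) x‖ ≤ c * T ^ i)
    {n : ℕ} (hn : n ≤ k) :
    ‖iteratedFDeriv ℝ n (fun y => σ ((∑ j, a j * h j y) + b)) x‖ ≤
      k.factorial * M * (N * c) ^ k * (S * T) ^ n := by
  have hM0 : 0 ≤ M := (abs_nonneg _).trans (hM 0 (Nat.zero_le k) 0)
  have hNc : 1 ≤ N * c := one_le_mul_of_one_le_of_one_le hN hc
  have hsum : ContDiff ℝ k fun y => ∑ j, a j * h j y :=
    ContDiff.sum fun j _ => contDiff_const.mul (hh j)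
  have hinner : ∀ i, 1 ≤ i → i ≤ n →
      ‖iteratedFDeriv ℝ i (fun y => (∑ j, a j * h j y) + b) x‖ ≤ (N * c * (S * T)) ^ i := by
    intro i hi hin
    have hik : (i : WithTop ℕ∞) ≤ k := by exact_mod_cast hin.trans hn
    rw [fun_iteratedFDeriv_add_apply (hsum.of_le hik).contDiffAt contDiffAt_const,
      iteratedFDeriv_const_of_ne (by omega), Pi.zero_apply, add_zero]
    calc _ ≤ (∑ j, |a j|) * (c * T ^ i) :=
          norm_iteratedFDeriv_sum_mul_le (fun j => (hh j).of_le hik)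
            fun j => hD j i hi (hin.trans hn)
      _ ≤ (N * S) * (c * T ^ i) := by
          gcongr
          calc ∑ j, |a j| ≤ ∑ _j : ι, S := Finset.sum_le_sum fun j _ => ha j
            _ = Fintype.card ι * S := by simp
            _ ≤ N * S := by gcongr
      _ = (N * c) * S * T ^ i := by ring
      _ ≤ (N * c) ^ i * S ^ i * T ^ i := by
          gcongr
          · exact le_self_pow₀ hNc (by omega)
          · exact le_self_pow₀ hS (by omega)
      _ = (N * c * (S * T)) ^ i := by ring
  calc _ ≤ n.factorial * M * (N * c * (S * T)) ^ n := by
        refine norm_iteratedFDeriv_comp_le hσ (hsum.add contDiff_const) (by exact_mod_cast hn) x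
          (fun i hi => ?_) hinner
        rw [norm_iteratedFDeriv_eq_norm_iteratedDeriv]
        exact hM i (hi.trans hn) _
    _ = n.factorial * M * (N * c) ^ n * (S * T) ^ n := by ring
    _ ≤ k.factorial * M * (N * c) ^ k * (S * T) ^ n := by
        gcongr

/-- Derivatives of positive order of a coordinate function have norm at most one. -/
lemma norm_iteratedFDeriv_coord_le {d : ℕ} (j : Fin d) (x : Fin d → ℝ) {i : ℕ} (hi : 1 ≤ i) :
    ‖iteratedFDeriv ℝ i (fun y : Fin d → ℝ => y j) x‖ ≤ 1 := by
  obtain ⟨m, rfl⟩ := Nat.exists_eq_add_of_le' hi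
  have hf : fderiv ℝ (fun y : Fin d → ℝ => y j) =
      fun _ => (ContinuousLinearMap.proj j : (Fin d → ℝ) →L[ℝ] ℝ) :=
    funext fun y => (ContinuousLinearMap.proj j : (Fin d → ℝ) →L[ℝ] ℝ).fderiv
  rw [← norm_iteratedFDeriv_fderiv, hf]
  rcases m with _ | m
  · rw [norm_iteratedFDeriv_zero]
    refine ContinuousLinearMap.opNorm_le_bound _ zero_le_one fun y => ?_
    simpa using norm_le_pi_norm y j
  · simp [iteratedFDeriv_const_of_ne]

lemma contDiff_hid {σ : ℝ → ℝ} {n : ℕ} (hσ : ContDiff ℝ n σ) {Kn L r d : ℕ}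
    (w : EuclideanSpace ℝ (Idx Kn L r d)) (k' : Fin Kn) (m : ℕ) (i : Fin r) :
    ContDiff ℝ n (hid σ Kn L r d w k' m i) := by
  induction m generalizing i with
  | zero =>
    exact hσ.comp ((ContDiff.sum fun j _ => contDiff_const.mul (contDiff_apply ℝ ℝ j)).add
      contDiff_const)
  | succ m ih =>
    exact hσ.comp ((ContDiff.sum fun j _ => contDiff_const.mul (ih j)).add contDiff_const)

/-- Derivatives of the neurons in layer `m + 1`, with a constant independent of the weights. -/
lemma exists_norm_iteratedFDeriv_hid_le {k : ℕ} {σ : ℝ → ℝ} (hσ : ContDiff ℝ k σ) {M : ℝ}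
    (hM1 : 1 ≤ M) (hM : ∀ i ≤ k, ∀ t, |iteratedDeriv i σ t| ≤ M) (L r d m : ℕ) :
    ∃ c : ℝ, 1 ≤ c ∧ ∀ (Kn : ℕ) (A B : ℝ), 1 ≤ A → 1 ≤ B →
      ∀ (w : EuclideanSpace ℝ (Idx Kn L r d)),
        (∀ (k' : Fin Kn) (l : Fin (L - 1)) (i : Fin r) (j : Fin r),
          |w (Sum.inr (Sum.inl (k', l, i, j.succ)))| ≤ B) →
        (∀ (k' : Fin Kn) (i : Fin r) (j : Fin d),
          |w (Sum.inl (k', i, j.succ))| ≤ A) →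
      ∀ (k' : Fin Kn) (i : Fin r) (x : Fin d → ℝ) (n : ℕ), n ≤ k →
        ‖iteratedFDeriv ℝ n (hid σ Kn L r d w k' m i) x‖ ≤ c * (A * B ^ m) ^ n := by
  have hfac : (1 : ℝ) ≤ k.factorial := by exact_mod_cast k.factorial_pos
  induction m with
  | zero =>
    have hN : (1 : ℝ) ≤ d + 1 := by simp
    refine ⟨k.factorial * M * ((d + 1) * 1) ^ k, ?_, ?_⟩
    · exact one_le_mul_of_one_le_of_one_le (one_le_mul_of_one_le_of_one_le hfac hM1)
        (one_le_pow₀ (by simp))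
    · intro Kn A B hA hB w _ hwA k' i x n hn
      rw [pow_zero]
      exact norm_iteratedFDeriv_neuron_le hσ hM (fun j => contDiff_apply ℝ ℝ j) le_rfl hN
        (by simp) hA zero_le_one (hwA k' i)
        (fun j i hi _ => by simpa using norm_iteratedFDeriv_coord_le j x hi) hn
  | succ m ih =>
    obtain ⟨c, hc, hbound⟩ := ih
    have hN : (1 : ℝ) ≤ r + 1 := by simp
    refine ⟨k.factorial * M * ((r + 1) * c) ^ k, ?_, ?_⟩
    · exact one_le_mul_of_one_le_of_one_le (one_le_mul_of_one_le_of_one_le hfac hM1)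
        (one_le_pow₀ (one_le_mul_of_one_le_of_one_le hN hc))
    · intro Kn A B hA hB w hwB hwA k' i x n hn
      have hpow : A * B ^ (m + 1) = B * (A * B ^ m) := by ring
      rw [hpow]
      refine norm_iteratedFDeriv_neuron_le hσ hM (fun j => contDiff_hid hσ w k' m j) hc hN
        (by simp) hB (by positivity) (fun j => ?_)
        (fun j i _ hi => hbound Kn A B hA hB w hwB hwA k' j x i hi) hn
      split_ifs
      · exact hwB k' _ i j
      · simpa using zero_le_one.trans hB

/-- Bound on the `k`-th order partial derivatives (in `x`) of the network. -/
theorem network_kth_partial_derivative_bound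
    (d r L k : ℕ) (hd : 0 < d) (hL : 2 ≤ L) (hr : 2 * d ≤ r) (hk : 0 < k)
    (σ : ℝ → ℝ) (hσ : ContDiff ℝ k σ)
    (hσbdd : ∀ i ≤ k, ∃ M, ∀ x, |iteratedDeriv i σ x| ≤ M) :
    ∃ c14 : ℝ, 0 < c14 ∧
      ∀ (Kn : ℕ) (A B C : ℝ), 1 ≤ A → 1 ≤ B → 1 ≤ C →
      ∀ (w : EuclideanSpace ℝ (Idx Kn L r d)),
        (∑ j : Fin Kn, |w (Sum.inr (Sum.inr j))|) ≤ C →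
        (∀ (k' : Fin Kn) (l : Fin (L - 1)) (i : Fin r) (j : Fin r),
          |w (Sum.inr (Sum.inl (k', l, i, j.succ)))| ≤ B) →
        (∀ (k' : Fin Kn) (i : Fin r) (j : Fin d),
          |w (Sum.inl (k', i, j.succ))| ≤ A) →
      ∀ (x : Fin d → ℝ) (s : Fin k → Fin d),
        |iteratedFDeriv ℝ k (netF σ Kn L r d w) x
            (fun i => Pi.single (s i) (1 : ℝ))| ≤
          c14 * C * B ^ ((L - 1) * k) * A ^ k := by
  choose! M hM using hσbdd
  obtain ⟨c, hc, hbound⟩ := exists_norm_iteratedFDeriv_hid_le hσ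
    (M := 1 + ∑ i ∈ Finset.range (k + 1), |M i|)
    (le_add_of_nonneg_right (Finset.sum_nonneg fun i _ => abs_nonneg _))
    (fun i hi t => by
      have hle := Finset.single_le_sum (f := fun i => |M i|) (fun i _ => abs_nonneg _)
        (Finset.mem_range_succ_iff.mpr hi)
      linarith [hM i hi t, le_abs_self (M i)]) L r d (L - 1)
  refine ⟨c, zero_lt_one.trans_le hc, fun Kn A B C hA hB hC w hwC hwB hwA x s => ?_⟩
  have hr0 : 0 < r := by omega
  have hnet : netF σ Kn L r d w = fun y => ∑ j : Fin Kn,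
      w (Sum.inr (Sum.inr j)) * hid σ Kn L r d w j (L - 1) ⟨0, hr0⟩ y := by
    funext y
    simp [netF, subnet, hr0]
  calc _ ≤ ‖iteratedFDeriv ℝ k (netF σ Kn L r d w) x‖ * ∏ i, ‖Pi.single (s i) (1 : ℝ)‖ :=
        ContinuousMultilinearMap.le_opNorm _ _
    _ = ‖iteratedFDeriv ℝ k (netF σ Kn L r d w) x‖ := by simp [Pi.norm_single]
    _ ≤ (∑ j : Fin Kn, |w (Sum.inr (Sum.inr j))|) * (c * (A * B ^ (L - 1)) ^ k) := by
        rw [hnet]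
        exact norm_iteratedFDeriv_sum_mul_le (fun j => contDiff_hid hσ w j _ _)
          fun j => hbound Kn A B hA hB w hwB hwA j _ x k le_rfl
    _ ≤ C * (c * (A * B ^ (L - 1)) ^ k) := by gcongr
    _ = c * C * B ^ ((L - 1) * k) * A ^ k := by
        rw [mul_pow, ← pow_mul]
        ring

end
end
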